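/- In the merged traveling-wave configuration, assume additionally there is M > 0 with v_λ(x) ≤ M e^x and v_{λ'}(x) ≤ M e^x for all x ≤ 0. Set v(x,τ) = min(u₁(x,τ), u₂(x,τ)), d = (γ_λ γ_{λ'} + (p − 1))/p, and F(τ) := ∫_ℝ v(x,τ)^p dx. Then F is differentiable and there exists a constant K > 0 such that lim_{τ→−∞} e^{−dτ} ( F'(τ) − ∫_ℝ v(x,τ)^p dx + ∫_ℝ v(x,τ) dx ) = (γ_λ + γ_{λ'}) K. -/

import Mathlib

open Real Filter Topology MeasureTheory

/-- A traveling-wave profile with speed `lam` for the cylindrical Yamabe-flow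
equation `(u^p)_τ = u_{xx} + u^p - u`: it is `C²`, takes values in `(0,1]`,
is strictly increasing, solves `v'' + λ p v^{p-1} v' + v^p - v = 0`,
tends to `0` at `-∞` and to `1` at `+∞`. -/
def IsTWProfile (p lam : ℝ) (v : ℝ → ℝ) : Prop :=
  ContDiff ℝ 2 v ∧ (∀ x, 0 < v x) ∧ (∀ x, v x ≤ 1) ∧ (∀ x, 0 < deriv v x) ∧
  (∀ x, deriv (deriv v) x + lam * p * v x ^ (p - 1) * deriv v x + v x ^ p - v x = 0) ∧
  Filter.Tendsto v Filter.atBot (nhds 0) ∧ Filter.Tendsto v Filter.atTop (nhds 1)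

/-- The profile `v` has exponential asymptotics at `+∞` with rate `gam` and
constant `C`: `v(x) = 1 - C e^{-γ x} + o(e^{-γ x})` where `γ` is a root of the
characteristic equation `γ² - λ p γ + (p-1) = 0`. -/
def HasExpAsym (p lam gam C : ℝ) (v : ℝ → ℝ) : Prop :=
  0 < gam ∧ 0 < C ∧ gam ^ 2 - lam * p * gam + (p - 1) = 0 ∧
  Filter.Tendsto (fun x => Real.exp (gam * x) * (1 - v x)) Filter.atTop (nhds C)


theorem tw_hasDerivAt {p lam : ℝ} {v : ℝ → ℝ} (H : IsTWProfile p lam v) (x : ℝ) :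
    HasDerivAt v (deriv v x) x :=
  ((H.1.differentiable (by norm_num)) x).hasDerivAt

theorem tw_strictMono {p lam : ℝ} {v : ℝ → ℝ} (H : IsTWProfile p lam v) : StrictMono v :=
  strictMono_of_deriv_pos H.2.2.2.1

theorem tw_lt_one {p lam : ℝ} {v : ℝ → ℝ} (H : IsTWProfile p lam v) (x : ℝ) : v x < 1 :=
  lt_of_lt_of_le (tw_strictMono H (lt_add_one x)) (H.2.2.1 _)

theorem tw_G_hasDerivAt {p lam : ℝ} {v : ℝ → ℝ} (H : IsTWProfile p lam v) (x : ℝ) :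
    HasDerivAt (fun y => deriv v y + lam * v y ^ p) (v x - v x ^ p) x := by
  have h1 : HasDerivAt (deriv v) (deriv (deriv v) x) x := by
    have h2 : ContDiff ℝ (1 + 1) v := by
      have := H.1
      norm_num
      exact this
    have := (contDiff_succ_iff_deriv.1 h2).2.2
    exact ((this.differentiable (by norm_num)) x).hasDerivAt
  have h3 := ((tw_hasDerivAt H x).rpow_const (p := p) (Or.inl (H.2.1 x).ne')).const_mul lam
  refine (h1.add h3).congr_deriv ?_
  have := H.2.2.2.2.1 x
  linarith

theorem tw_pow_le {p lam : ℝ} {v : ℝ → ℝ} (hp : 1 < p) (H : IsTWProfile p lam v) (x : ℝ) :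
    v x ^ p ≤ v x := by
  have := Real.rpow_le_rpow_of_exponent_ge (H.2.1 x) (H.2.2.1 x) hp.le
  simpa using this

theorem tw_G_mono {p lam : ℝ} {v : ℝ → ℝ} (hp : 1 < p) (H : IsTWProfile p lam v) :
    Monotone (fun y => deriv v y + lam * v y ^ p) := by
  refine monotone_of_deriv_nonneg (fun x => (tw_G_hasDerivAt H x).differentiableAt) (fun x => ?_)
  rw [(tw_G_hasDerivAt H x).deriv]
  linarith [tw_pow_le hp H x]

theorem tw_G_tendsto {p lam : ℝ} {v : ℝ → ℝ} (hp : 1 < p) (H : IsTWProfile p lam v) :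
    Tendsto (fun y => deriv v y + lam * v y ^ p) atTop (𝓝 lam) ∧
    Tendsto (fun y => deriv v y + lam * v y ^ p) atBot (𝓝 0) := by
  have hex : ∀ x : ℝ, ∃ c ∈ Set.Ioo x (x + 1), deriv v c = v (x + 1) - v x := by
    intro x
    obtain ⟨c, hc, h⟩ := exists_deriv_eq_slope v (lt_add_one x)
      H.1.continuous.continuousOn (H.1.differentiable (by norm_num)).differentiableOn
    exact ⟨c, hc, by simpa using h⟩
  choose φ hφ hφd using hex
  have htop : Tendsto φ atTop atTop := tendsto_atTop_mono (fun x => (hφ x).1.le) tendsto_id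
  have hbot : Tendsto φ atBot atBot :=
    tendsto_atBot_mono (fun x => (hφ x).2.le) (tendsto_atBot_add_const_right _ _ tendsto_id)
  have hv0 := H.2.2.2.2.2.1
  have hv1 := H.2.2.2.2.2.2
  have hp0 : (0:ℝ) < p := by linarith
  have key1 : Tendsto (fun x => deriv v (φ x) + lam * v (φ x) ^ p) atTop (𝓝 lam) := by
    have a1 : Tendsto (fun x => v (x + 1) - v x) atTop (𝓝 (1 - 1)) :=
      (hv1.comp (tendsto_atTop_add_const_right _ _ tendsto_id)).sub hv1
    have a2 : Tendsto (fun x => v (φ x) ^ p) atTop (𝓝 (1 ^ p)) :=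
      (hv1.comp htop).rpow_const (Or.inl one_ne_zero)
    have := a1.add (a2.const_mul lam)
    simp only [← hφd, Real.one_rpow, sub_self, zero_add, mul_one] at this
    exact this
  have key0 : Tendsto (fun x => deriv v (φ x) + lam * v (φ x) ^ p) atBot (𝓝 0) := by
    have a1 : Tendsto (fun x => v (x + 1) - v x) atBot (𝓝 (0 - 0)) :=
      (hv0.comp (tendsto_atBot_add_const_right _ _ tendsto_id)).sub hv0
    have a2 : Tendsto (fun x => v (φ x) ^ p) atBot (𝓝 (0 ^ p)) :=
      (hv0.comp hbot).rpow_const (Or.inr hp0.le)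
    have := a1.add (a2.const_mul lam)
    simp only [← hφd, Real.zero_rpow hp0.ne', sub_self, zero_add, mul_zero] at this
    exact this
  have hm := tw_G_mono hp H
  refine ⟨(tendsto_iff_tendsto_subseq_of_monotone hm htop).2 key1, ?_⟩
  have hanti : Antitone (fun y => deriv v (-y) + lam * v (-y) ^ p) :=
    fun a b hab => hm (neg_le_neg hab)
  have hψ : Tendsto (fun x => -φ (-x)) atTop atTop :=
    tendsto_neg_atBot_atTop.comp (hbot.comp tendsto_neg_atTop_atBot)
  have := (tendsto_iff_tendsto_subseq_of_antitone (l := 0) hanti hψ).2 (by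
    have := key0.comp tendsto_neg_atTop_atBot
    refine this.congr fun x => ?_
    simp)
  have := this.comp tendsto_neg_atBot_atTop
  refine this.congr fun x => ?_
  simp

theorem tw_slope {p lam : ℝ} {v : ℝ → ℝ} (H : IsTWProfile p lam v) :
    Tendsto (fun x => (1 - v x ^ p) / (1 - v x)) atTop (𝓝 p) := by
  have h1 : HasDerivAt (fun x : ℝ => x ^ p) p 1 := by
    simpa using Real.hasDerivAt_rpow_const (x := 1) (p := p) (Or.inl one_ne_zero)
  have h2 := hasDerivAt_iff_tendsto_slope.1 h1
  have h3 : Tendsto v atTop (𝓝[≠] 1) :=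
    tendsto_nhdsWithin_iff.2 ⟨H.2.2.2.2.2.2, Eventually.of_forall fun x => (tw_lt_one H x).ne⟩
  refine (h2.comp h3).congr fun x => ?_
  simp only [Function.comp, slope_def_field, Real.one_rpow]
  rw [← neg_sub (1:ℝ) (v x ^ p), ← neg_sub (1:ℝ) (v x), neg_div_neg_eq]

theorem tw_ratio {p lam gam C : ℝ} {v : ℝ → ℝ} (hp : 1 < p) (H : IsTWProfile p lam v)
    (A : HasExpAsym p lam gam C v) :
    Tendsto (fun x => deriv v x / (1 - v x)) atTop (𝓝 gam) := by
  obtain ⟨hg, hC, hq, hA⟩ := A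
  have hpos : ∀ x, 0 < 1 - v x := fun x => by linarith [tw_lt_one H x]
  have hs := tw_slope H
  have hs2 : Tendsto (fun x => (v x - v x ^ p) / (1 - v x)) atTop (𝓝 (p - 1)) := by
    refine (hs.sub_const 1).congr fun x => ?_
    have := (hpos x).ne'
    field_simp
    ring
  have hl : Tendsto (fun x => ((deriv v x + lam * v x ^ p) - lam) / Real.exp (-gam * x)) atTop
      (𝓝 (-((p - 1) * C / gam))) := by
    refine HasDerivAt.lhopital_zero_atTop (f' := fun x => v x - v x ^ p)
      (g' := fun x => Real.exp (-gam * x) * (-gam)) ?_ ?_ ?_ ?_ ?_ ?_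
    · exact Eventually.of_forall fun x => (tw_G_hasDerivAt H x).sub_const lam
    · refine Eventually.of_forall fun x => ?_
      have := ((hasDerivAt_id x).const_mul (-gam)).exp
      simpa using this
    · exact Eventually.of_forall fun x =>
        mul_ne_zero (Real.exp_pos _).ne' (neg_ne_zero.2 hg.ne')
    · simpa using (tw_G_tendsto hp H).1.sub_const lam
    · exact Real.tendsto_exp_atBot.comp
        (tendsto_id.const_mul_atTop_of_neg (by linarith))
    · have := ((hs2.mul hA).div_const gam).neg
      refine this.congr fun x => ?_
      have h1 := (hpos x).ne'
      rw [neg_mul, Real.exp_neg]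
      have h2 := (Real.exp_pos (gam * x)).ne'
      field_simp
  have h3 := (hl.div hA hC.ne').add (hs.const_mul lam)
  have e : -((p - 1) * C / gam) / C + lam * p = gam := by
    field_simp
    linarith
  rw [e] at h3
  refine h3.congr fun x => ?_
  have h1 := (hpos x).ne'
  have h2 := (Real.exp_pos (gam * x)).ne'
  simp only [Pi.div_apply]
  rw [neg_mul, Real.exp_neg]
  field_simp
  ring

theorem tw_integrable {p lam M : ℝ} {v : ℝ → ℝ} (H : IsTWProfile p lam v)
    (hb : ∀ x ≤ (0:ℝ), v x ≤ M * Real.exp x) (y : ℝ) : IntegrableOn v (Set.Iic y) := by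
  have hc : Continuous v := H.1.continuous
  have h0 : IntegrableOn v (Set.Iic 0) := by
    refine Integrable.mono' ((integrableOn_exp_Iic 0).const_mul M)
      hc.aestronglyMeasurable.restrict ?_
    refine (ae_restrict_iff' measurableSet_Iic).2 (Eventually.of_forall fun x hx => ?_)
    rw [Real.norm_eq_abs, abs_of_pos (H.2.1 x)]
    exact hb x hx
  refine (h0.union (hc.integrableOn_Icc (a := 0) (b := y))).mono_set fun x hx => ?_
  rcases le_total x 0 with h | h
  · exact Or.inl h
  · exact Or.inr ⟨h, hx⟩

theorem tw_cont_pow {p lam : ℝ} {v : ℝ → ℝ} (hp : 1 < p) (H : IsTWProfile p lam v) :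
    Continuous (fun x => v x ^ p) :=
  H.1.continuous.rpow_const fun _ => Or.inr (by linarith)

theorem tw_integrable_pow {p lam M : ℝ} {v : ℝ → ℝ} (hp : 1 < p) (H : IsTWProfile p lam v)
    (hb : ∀ x ≤ (0:ℝ), v x ≤ M * Real.exp x) (y : ℝ) :
    IntegrableOn (fun x => v x ^ p) (Set.Iic y) := by
  refine Integrable.mono' (tw_integrable H hb y)
    (tw_cont_pow hp H).aestronglyMeasurable.restrict (Eventually.of_forall fun x => ?_)
  rw [Real.norm_eq_abs, abs_of_pos (Real.rpow_pos_of_pos (H.2.1 x) p)]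
  exact tw_pow_le hp H x

theorem tw_integral {p lam M : ℝ} {v : ℝ → ℝ} (hp : 1 < p) (H : IsTWProfile p lam v)
    (hb : ∀ x ≤ (0:ℝ), v x ≤ M * Real.exp x) (y : ℝ) :
    (∫ x in Set.Iic y, v x) - (∫ x in Set.Iic y, v x ^ p) = deriv v y + lam * v y ^ p := by
  have h1 := tw_integrable H hb y
  have h2 := tw_integrable_pow hp H hb y
  rw [← integral_sub h1 h2]
  have := integral_Iic_of_hasDerivAt_of_tendsto' (a := y) (fun x _ => tw_G_hasDerivAt H x)
    (h1.sub h2) (tw_G_tendsto hp H).2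
  simpa using this

theorem tw_A_hasDerivAt {p lam M : ℝ} {v : ℝ → ℝ} (hp : 1 < p) (H : IsTWProfile p lam v)
    (hb : ∀ x ≤ (0:ℝ), v x ≤ M * Real.exp x) (y : ℝ) :
    HasDerivAt (fun y => ∫ x in Set.Iic y, v x ^ p) (v y ^ p) y := by
  have hc := tw_cont_pow hp H
  have h1 := intervalIntegral.integral_hasDerivAt_right (a := 0) (b := y)
    (hc.intervalIntegrable _ _) (hc.stronglyMeasurableAtFilter _ _) hc.continuousAt
  have h2 := h1.const_add (∫ x in Set.Iic 0, v x ^ p)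
  refine h2.congr_of_eventuallyEq (Eventually.of_forall fun z => ?_)
  have := intervalIntegral.integral_Iic_sub_Iic (tw_integrable_pow hp H hb 0)
    (tw_integrable_pow hp H hb z)
  simp only
  linarith

theorem split_integral (f f1 f2 : ℝ → ℝ) (a b s : ℝ)
    (h1 : ∀ x ≤ s, f x = f1 (x + a)) (h2 : ∀ x > s, f x = f2 (-x + b))
    (i1 : IntegrableOn f1 (Set.Iic (s + a))) (i2 : IntegrableOn f2 (Set.Iic (-s + b))) :
    ∫ x, f x = (∫ x in Set.Iic (s + a), f1 x) + ∫ x in Set.Iic (-s + b), f2 x := by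
  have m1 : MeasurePreserving (fun x : ℝ => x + a) volume volume :=
    measurePreserving_add_right volume a
  have e1 : MeasurableEmbedding (fun x : ℝ => x + a) := measurableEmbedding_addRight a
  have m2 : MeasurePreserving (fun x : ℝ => b - x) volume volume :=
    Measure.measurePreserving_sub_left volume b
  have e2 : MeasurableEmbedding (fun x : ℝ => b - x) := (Homeomorph.subLeft b).measurableEmbedding
  have p1 : (fun x : ℝ => x + a) ⁻¹' (Set.Iic (s + a)) = Set.Iic s := by ext x; simp
  have p2 : (fun x : ℝ => b - x) ⁻¹' (Set.Iic (-s + b)) = Set.Ici s := by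
    ext x
    simp only [Set.mem_preimage, Set.mem_Iic, Set.mem_Ici]
    constructor <;> intro h <;> linarith
  have j1 := (m1.integrableOn_comp_preimage e1).2 i1
  have j2 := (m2.integrableOn_comp_preimage e2).2 i2
  have k1 := m1.setIntegral_preimage_emb e1 f1 (Set.Iic (s + a))
  have k2 := m2.setIntegral_preimage_emb e2 f2 (Set.Iic (-s + b))
  rw [p1] at j1 k1
  rw [p2] at j2 k2
  rw [integral_Ici_eq_integral_Ioi] at k2
  have j2' := j2.mono_set Set.Ioi_subset_Ici_self
  have c1 : Set.EqOn f (fun x => f1 (x + a)) (Set.Iic s) := fun x hx => h1 x hx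
  have c2 : Set.EqOn f (fun x => f2 (b - x)) (Set.Ioi s) := fun x hx => by
    rw [h2 x hx]; simp only; congr 1; ring
  rw [← intervalIntegral.integral_Iic_add_Ioi (b := s) (f := f)
    (IntegrableOn.congr_fun j1 c1.symm measurableSet_Iic)
    (IntegrableOn.congr_fun j2' c2.symm measurableSet_Ioi),
    setIntegral_congr_fun measurableSet_Iic c1, setIntegral_congr_fun measurableSet_Ioi c2,
    k1, k2]

theorem tw_cross {p lam lam' : ℝ} {v w : ℝ → ℝ} (H : IsTWProfile p lam v)
    (H' : IsTWProfile p lam' w) (T : ℝ) : ∃ y, v y = w (T - y) := by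
  have hc : Continuous (fun y => v y - w (T - y)) :=
    H.1.continuous.sub (H'.1.continuous.comp (continuous_const.sub continuous_id))
  have t1 : Tendsto (fun y : ℝ => T - y) atTop atBot := by
    simpa [sub_eq_add_neg] using tendsto_atBot_add_const_left _ T tendsto_neg_atTop_atBot
  have t2 : Tendsto (fun y : ℝ => T - y) atBot atTop := by
    simpa [sub_eq_add_neg] using tendsto_atTop_add_const_left _ T tendsto_neg_atBot_atTop
  have l1 : Tendsto (fun y => v y - w (T - y)) atTop (𝓝 (1 - 0)) :=
    H.2.2.2.2.2.2.sub (H'.2.2.2.2.2.1.comp t1)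
  have l2 : Tendsto (fun y => v y - w (T - y)) atBot (𝓝 (0 - 1)) :=
    H.2.2.2.2.2.1.sub (H'.2.2.2.2.2.2.comp t2)
  obtain ⟨a, ha⟩ := (l1.eventually (lt_mem_nhds (show (0:ℝ) < 1 - 0 by norm_num))).exists
  obtain ⟨b, hb⟩ := (l2.eventually (gt_mem_nhds (show (0:ℝ) - 1 < 0 by norm_num))).exists
  obtain ⟨y, hy⟩ := mem_range_of_exists_le_of_exists_ge hc ⟨b, hb.le⟩ ⟨a, ha.le⟩
  exact ⟨y, sub_eq_zero.1 hy⟩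

theorem tw_cross_atTop {p lam lam' : ℝ} {v w : ℝ → ℝ} (H : IsTWProfile p lam v)
    (H' : IsTWProfile p lam' w) (y z : ℝ → ℝ) (hyz : ∀ t, v (y t) = w (z t))
    (hT : Tendsto (fun t => y t + z t) atBot atTop) : Tendsto y atBot atTop := by
  refine tendsto_atTop.2 fun N => ?_
  obtain ⟨N', hN'⟩ := (H'.2.2.2.2.2.2.eventually (lt_mem_nhds (tw_lt_one H N))).exists
  filter_upwards [hT.eventually_gt_atTop (N + N')] with t ht
  by_contra! hlt
  have h1 := tw_strictMono H' (show N' < z t by linarith)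
  have h2 := tw_strictMono H hlt
  have := hyz t
  linarith

theorem envelope_deriv (A B : ℝ → ℝ) (y z : ℝ → ℝ) (L H w t : ℝ)
    (hA : HasDerivAt A w (y t)) (hB : HasDerivAt B w (z t))
    (hsum : ∀ τ, y τ + z τ = -L * τ + H)
    (hmon : ∀ τ, 0 ≤ (y τ - y t) * (z τ - z t)) :
    HasDerivAt (fun τ => A (y τ) + B (z τ)) (-L * w) t := by
  have by1 : ∀ τ, ‖y τ - y t‖ ≤ |L| * ‖τ - t‖ := by
    intro τ
    have e : (y τ - y t) + (z τ - z t) = -L * (τ - t) := by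
      have := hsum τ; have := hsum t; linarith
    have := hmon τ
    rw [Real.norm_eq_abs, Real.norm_eq_abs, ← abs_mul]
    refine sq_le_sq.1 ?_
    have : (L * (τ - t)) ^ 2 = ((y τ - y t) + (z τ - z t)) ^ 2 := by rw [e]; ring
    nlinarith [sq_nonneg (z τ - z t)]
  have bz1 : ∀ τ, ‖z τ - z t‖ ≤ |L| * ‖τ - t‖ := by
    intro τ
    have e : (y τ - y t) + (z τ - z t) = -L * (τ - t) := by
      have := hsum τ; have := hsum t; linarith
    have := hmon τ
    rw [Real.norm_eq_abs, Real.norm_eq_abs, ← abs_mul]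
    refine sq_le_sq.1 ?_
    have : (L * (τ - t)) ^ 2 = ((y τ - y t) + (z τ - z t)) ^ 2 := by rw [e]; ring
    nlinarith [sq_nonneg (y τ - y t)]
  have oy : (fun τ => y τ - y t) =O[𝓝 t] (fun τ => τ - t) :=
    Asymptotics.IsBigO.of_bound |L| (Eventually.of_forall by1)
  have oz : (fun τ => z τ - z t) =O[𝓝 t] (fun τ => τ - t) :=
    Asymptotics.IsBigO.of_bound |L| (Eventually.of_forall bz1)
  have hlin : Tendsto (fun τ : ℝ => τ - t) (𝓝 t) (𝓝 0) := by
    have : Continuous (fun τ : ℝ => τ - t) := by fun_prop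
    simpa using this.tendsto t
  have cy : Tendsto y (𝓝 t) (𝓝 (y t)) := tendsto_sub_nhds_zero_iff.1 (oy.trans_tendsto hlin)
  have cz : Tendsto z (𝓝 t) (𝓝 (z t)) := tendsto_sub_nhds_zero_iff.1 (oz.trans_tendsto hlin)
  have lA := (hA.isLittleO.comp_tendsto cy).trans_isBigO oy
  have lB := (hB.isLittleO.comp_tendsto cz).trans_isBigO oz
  refine HasDerivAt.of_isLittleO ((lA.add lB).congr_left fun τ => ?_)
  have e : (y τ - y t) + (z τ - z t) = -L * (τ - t) := by
    have := hsum τ; have := hsum t; linarith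
  simp only [Function.comp, smul_eq_mul]
  linear_combination (-w) * e

theorem deriv_integral_asymptotics
    (p lam lam' h h' gam gam' C C' M d : ℝ)
    (hp : 1 < p) (hlam : 1 ≤ lam) (hlam' : 1 ≤ lam')
    (vl vl' : ℝ → ℝ)
    (hprof : IsTWProfile p lam vl) (hprof' : IsTWProfile p lam' vl')
    (hasym : HasExpAsym p lam gam C vl) (hasym' : HasExpAsym p lam' gam' C' vl')
    (hM : 0 < M)
    (hb : ∀ x ≤ (0:ℝ), vl x ≤ M * Real.exp x)
    (hb' : ∀ x ≤ (0:ℝ), vl' x ≤ M * Real.exp x)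
    (hd : d = (gam * gam' + (p - 1)) / p)
    (v : ℝ → ℝ → ℝ)
    (hv : ∀ x τ, v x τ = min (vl (x - lam * τ + h)) (vl' (-x - lam' * τ + h')))
    (F : ℝ → ℝ) (hF : ∀ τ, F τ = ∫ x, v x τ ^ p) :
    Differentiable ℝ F ∧
    ∃ K > 0,
      Tendsto (fun τ => Real.exp (-(d * τ)) *
          (deriv F τ - (∫ x, v x τ ^ p) + (∫ x, v x τ)))
        atBot (𝓝 ((gam + gam') * K)) := by
  have hp0 : 0 < p := by linarith
  obtain ⟨hg, hC, hq, hA⟩ := id hasym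
  obtain ⟨hg', hC', hq', hA'⟩ := id hasym'
  choose Y hY using tw_cross hprof hprof'
  set T : ℝ → ℝ := fun τ => -(lam + lam') * τ + (h + h') with hT
  set y : ℝ → ℝ := fun τ => Y (T τ) with hy
  set z : ℝ → ℝ := fun τ => T τ - y τ with hz
  have hyz : ∀ τ, vl (y τ) = vl' (z τ) := fun τ => hY (T τ)
  have hsum : ∀ τ, y τ + z τ = -(lam + lam') * τ + (h + h') := fun τ => by
    simp only [hz, hT]; ring
  have sm := tw_strictMono hprof
  have sm' := tw_strictMono hprof'
  have hlow : ∀ τ, ∀ x ≤ y τ + lam * τ - h, v x τ = vl (x + (-(lam * τ) + h)) := by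
    intro τ x hx
    rw [hv, show x - lam * τ + h = x + (-(lam * τ) + h) by ring]
    refine min_eq_left ?_
    have h1 : vl (x + (-(lam * τ) + h)) ≤ vl (y τ) := sm.monotone (by linarith)
    have h2 : vl' (z τ) ≤ vl' (-x - lam' * τ + h') := sm'.monotone (by
      have := hsum τ; linarith)
    rw [hyz] at h1
    exact h1.trans h2
  have hhigh : ∀ τ, ∀ x > y τ + lam * τ - h, v x τ = vl' (-x + (-(lam' * τ) + h')) := by
    intro τ x hx
    rw [hv, show -x - lam' * τ + h' = -x + (-(lam' * τ) + h') by ring]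
    refine min_eq_right ?_
    have h1 : vl (y τ) ≤ vl (x - lam * τ + h) := sm.monotone (by linarith)
    have h2 : vl' (-x + (-(lam' * τ) + h')) ≤ vl' (z τ) := sm'.monotone (by
      have := hsum τ; linarith)
    rw [hyz] at h1
    exact h2.trans h1
  have e1 : ∀ τ, (y τ + lam * τ - h) + (-(lam * τ) + h) = y τ := fun τ => by ring
  have e2 : ∀ τ, -(y τ + lam * τ - h) + (-(lam' * τ) + h') = z τ := fun τ => by
    have := hsum τ; linarith
  have I1 : ∀ τ, ∫ x, v x τ = (∫ x in Set.Iic (y τ), vl x) + ∫ x in Set.Iic (z τ), vl' x := by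
    intro τ
    have := split_integral (fun x => v x τ) vl vl' _ _ _ (hlow τ) (hhigh τ)
      (tw_integrable hprof hb _) (tw_integrable hprof' hb' _)
    rwa [e1, e2] at this
  have I2 : ∀ τ, ∫ x, v x τ ^ p =
      (∫ x in Set.Iic (y τ), vl x ^ p) + ∫ x in Set.Iic (z τ), vl' x ^ p := by
    intro τ
    have := split_integral (fun x => v x τ ^ p) (fun x => vl x ^ p) (fun x => vl' x ^ p) _ _ _
      (fun x hx => by rw [hlow τ x hx]) (fun x hx => by rw [hhigh τ x hx])
      (tw_integrable_pow hp hprof hb _) (tw_integrable_pow hp hprof' hb' _)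
    rwa [e1, e2] at this
  have hmon : ∀ t τ, 0 ≤ (y τ - y t) * (z τ - z t) := by
    intro t τ
    rcases le_total (y t) (y τ) with hle | hle
    · have : z t ≤ z τ := by
        rw [← sm'.le_iff_le, ← hyz, ← hyz]; exact sm.monotone hle
      exact mul_nonneg (by linarith) (by linarith)
    · have : z τ ≤ z t := by
        rw [← sm'.le_iff_le, ← hyz, ← hyz]; exact sm.monotone hle
      exact mul_nonneg_of_nonpos_of_nonpos (by linarith) (by linarith)
  have hFd : ∀ t, HasDerivAt F (-(lam + lam') * vl (y t) ^ p) t := by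
    intro t
    have hB := tw_A_hasDerivAt hp hprof' hb' (z t)
    rw [← hyz] at hB
    have := envelope_deriv _ _ y z (lam + lam') (h + h') _ t
      (tw_A_hasDerivAt hp hprof hb (y t)) hB hsum (hmon t)
    refine this.congr_of_eventuallyEq (Eventually.of_forall fun τ => ?_)
    simp only [hF, I2]
  refine ⟨fun t => (hFd t).differentiableAt, ?_⟩
  have hmain : ∀ τ, deriv F τ - (∫ x, v x τ ^ p) + (∫ x, v x τ)
      = deriv vl (y τ) + deriv vl' (z τ) := by
    intro τ
    have a1 := tw_integral hp hprof hb (y τ)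
    have a2 := tw_integral hp hprof' hb' (z τ)
    rw [← hyz] at a2
    rw [(hFd τ).deriv, I1, I2]
    linear_combination a1 + a2
  have hTt : Tendsto (fun τ => y τ + z τ) atBot atTop := by
    simp only [hsum]
    exact tendsto_atTop_add_const_right _ _
      (tendsto_id.const_mul_atBot_of_neg (by linarith))
  have ty := tw_cross_atTop hprof hprof' y z hyz hTt
  have tz := tw_cross_atTop hprof' hprof z y (fun t => (hyz t).symm)
    (by simpa only [add_comm] using hTt)
  have hpos : ∀ τ, 0 < 1 - vl (y τ) := fun τ => by linarith [tw_lt_one hprof (y τ)]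
  have b1 : Tendsto (fun τ => Real.exp (gam * y τ) * (1 - vl (y τ))) atBot (𝓝 C) := hA.comp ty
  have b2 : Tendsto (fun τ => Real.exp (gam' * z τ) * (1 - vl (y τ))) atBot (𝓝 C') :=
    (hA'.comp tz).congr fun τ => by simp only [Function.comp, hyz]
  have hgg : 0 < gam + gam' := by linarith
  have hdl : d * (gam + gam') = gam * gam' * (lam + lam') := by
    rw [hd]
    field_simp
    linear_combination gam' * hq + gam * hq'
  set S := gam + gam' with hS
  set K0 : ℝ := C ^ (gam' / S) * C' ^ (gam / S) with hK0
  have hK0p : 0 < K0 := by positivity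
  have b3 : Tendsto (fun τ => (Real.exp (gam * y τ) * (1 - vl (y τ))) ^ (gam' / S) *
      (Real.exp (gam' * z τ) * (1 - vl (y τ))) ^ (gam / S)) atBot (𝓝 K0) :=
    (b1.rpow_const (Or.inl hC.ne')).mul (b2.rpow_const (Or.inl hC'.ne'))
  set K : ℝ := Real.exp (-(gam * gam' / S * (h + h'))) * K0 with hK
  have hKp : 0 < K := by positivity
  have b4 : Tendsto (fun τ => Real.exp (-(d * τ)) * (1 - vl (y τ))) atBot (𝓝 K) := by
    refine (b3.const_mul (Real.exp (-(gam * gam' / S * (h + h'))))).congr fun τ => ?_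
    have hw := hpos τ
    rw [Real.mul_rpow (Real.exp_pos _).le hw.le, Real.mul_rpow (Real.exp_pos _).le hw.le,
      ← Real.exp_mul, ← Real.exp_mul]
    have r1 : (1 - vl (y τ)) ^ (gam' / S) * (1 - vl (y τ)) ^ (gam / S) = 1 - vl (y τ) := by
      rw [← Real.rpow_add hw, ← add_div, add_comm, ← hS, div_self hgg.ne', Real.rpow_one]
    have r2 : Real.exp (-(d * τ)) = Real.exp (-(gam * gam' / S * (h + h'))) *
        (Real.exp (gam * y τ * (gam' / S)) * Real.exp (gam' * z τ * (gam / S))) := by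
      rw [← Real.exp_add, ← Real.exp_add]
      congr 1
      have hs := hsum τ
      have hz' : z τ = -(lam + lam') * τ + (h + h') - y τ := by linarith
      rw [hz']
      field_simp
      linear_combination (-τ) * hdl
    rw [r2]
    conv_rhs => rw [← r1]
    ring
  refine ⟨K, hKp, ?_⟩
  have c1 : Tendsto (fun τ => deriv vl (y τ) / (1 - vl (y τ))) atBot (𝓝 gam) :=
    (tw_ratio hp hprof hasym).comp ty
  have c2 : Tendsto (fun τ => deriv vl' (z τ) / (1 - vl (y τ))) atBot (𝓝 gam') :=
    ((tw_ratio hp hprof' hasym').comp tz).congr fun τ => by simp only [Function.comp, hyz]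
  refine ((c1.add c2).mul b4).congr fun τ => ?_
  rw [hmain]
  have := (hpos τ).ne'
  field_simp
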